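/- Let Z_2(G_n) = (T_2(G_n) - E T_2(G_n))/√(Var T_2(G_n)) be the standardized number of monochromatic edges under uniform c-coloring of a finite simple graph G_n. Then E[Z_2(G_n)^4] - 3 = (γ_1 |E(G_n)| + γ_2 N(K_3, G_n) + γ_3 N(C_4, G_n)) / σ^4, where σ^2 = (|E(G_n)|/c)(1 - 1/c), γ_1 = (1/c)(1 - 7/c + 12/c^2 - 6/c^3), γ_2 = (36/c^2)(1 - 1/c)(1 - 2/c), and γ_3 = (24/c^3)(1 - 1/c). -/

import Mathlib

open Finset

/-- The number of monochromatic edges of `G` under the coloring `X`. -/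
def monochromaticEdges {V : Type*} [Fintype V] [DecidableEq V] (G : SimpleGraph V)
    [DecidableRel G.Adj] {c : ℕ} (X : V → Fin c) : ℕ :=
  (G.edgeFinset.filter fun e => (e.map X).IsDiag).card

/-- The number of ordered (labelled) 4-cycles of `G`; the number of unlabelled 4-cycles is
`N(C₄, G) = orderedFourCycles G / 8`. -/
noncomputable def orderedFourCycles {V : Type*} (G : SimpleGraph V) : ℕ :=
  Nat.card {v : Fin 4 → V // Function.Injective v ∧ G.Adj (v 0) (v 1) ∧ G.Adj (v 1) (v 2)
    ∧ G.Adj (v 2) (v 3) ∧ G.Adj (v 3) (v 0)}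

namespace FM

set_option linter.all false
set_option linter.unusedSectionVars false
set_option maxHeartbeats 1000000

variable {V : Type*} [Fintype V] [DecidableEq V]

/-- expectation over a uniform coloring -/
noncomputable def Ex {c : ℕ} (g : (V → Fin c) → ℝ) : ℝ := (∑ X, g X) / (c : ℝ) ^ Fintype.card V

/-- centered monochromatic indicator -/
noncomputable def y {c : ℕ} (e : Sym2 V) (X : V → Fin c) : ℝ :=
  (if (e.map X).IsDiag then 1 else 0) - 1 / (c : ℝ)

/-- ordered triangles of edges -/
def Tri (e f g : Sym2 V) : Prop :=
  ∃ u v w : V, u ≠ v ∧ v ≠ w ∧ w ≠ u ∧ e = s(u, v) ∧ f = s(v, w) ∧ g = s(w, u)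

/-- cyclically ordered four-cycles of edges -/
def Cyc (e f g h : Sym2 V) : Prop :=
  ∃ a b c d : V, a ≠ b ∧ a ≠ c ∧ a ≠ d ∧ b ≠ c ∧ b ≠ d ∧ c ≠ d ∧
    e = s(a, b) ∧ f = s(b, c) ∧ g = s(c, d) ∧ h = s(d, a)

lemma Cyc.rot {e f g h : Sym2 V} : Cyc e f g h → Cyc f g h e := by
  rintro ⟨a, b, c, d, h1, h2, h3, h4, h5, h6, rfl, rfl, rfl, rfl⟩
  exact ⟨b, c, d, a, h4, h5, h1.symm, h6, h2.symm, h3.symm, rfl, rfl, rfl, rfl⟩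

lemma Cyc.rev {e f g h : Sym2 V} : Cyc e f g h → Cyc h g f e := by
  rintro ⟨a, b, c, d, h1, h2, h3, h4, h5, h6, rfl, rfl, rfl, rfl⟩
  exact ⟨a, d, c, b, h3, h2, h1, h6.symm, h5.symm, h4.symm, Sym2.eq_swap, Sym2.eq_swap,
    Sym2.eq_swap, Sym2.eq_swap⟩

lemma Cyc.facts {e f g h : Sym2 V} : Cyc e f g h → e ≠ f ∧ e ≠ g ∧ e ≠ h ∧ f ≠ g ∧ f ≠ h ∧ g ≠ h ∧
    (∀ v, v ∈ e → v ∉ g) ∧ (∃ v, v ∈ e ∧ v ∈ f) ∧ (∃ v, v ∈ e ∧ v ∈ h) := by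
  rintro ⟨a, b, c, d, h1, h2, h3, h4, h5, h6, rfl, rfl, rfl, rfl⟩
  refine ⟨?_, ?_, ?_, ?_, ?_, ?_, ?_, ⟨b, by simp⟩, ⟨a, by simp⟩⟩ <;>
    simp only [ne_eq, Sym2.eq_iff, Sym2.mem_iff] <;> grind

lemma Tri.facts {e f g : Sym2 V} : Tri e f g → e ≠ f ∧ e ≠ g ∧ f ≠ g := by
  rintro ⟨a, b, c, h1, h2, h3, rfl, rfl, rfl⟩
  refine ⟨?_, ?_, ?_⟩ <;> simp only [ne_eq, Sym2.eq_iff] <;> grind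

lemma cyc_aux {a b : V} {e f g h : Sym2 V} (he : e = s(a, b)) (hab : a ≠ b)
    (hf : ¬ f.IsDiag) (hg : ¬ g.IsDiag) (hh : ¬ h.IsDiag)
    (hef : e ≠ f) (heg : e ≠ g) (heh : e ≠ h) (hfg : f ≠ g) (hfh : f ≠ h) (hgh : g ≠ h)
    (cf : ∀ v ∈ f, v ∈ e ∨ v ∈ g ∨ v ∈ h) (cg : ∀ v ∈ g, v ∈ e ∨ v ∈ f ∨ v ∈ h)
    (ch : ∀ v ∈ h, v ∈ e ∨ v ∈ f ∨ v ∈ g) (haf : a ∈ f) (hbg : b ∈ g) : Cyc f e g h := by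
  obtain ⟨x, rfl⟩ := haf
  obtain ⟨z, rfl⟩ := hbg
  subst he
  simp only [Sym2.mk_isDiag_iff] at hf hg
  induction h with | _ p q =>
  simp only [Sym2.mk_isDiag_iff] at hh
  simp only [Sym2.mem_iff, ne_eq, Sym2.eq_iff] at *
  have c1 := cf x (Or.inr rfl)
  have c2 := cg z (Or.inr rfl)
  have c3 := ch p (Or.inl rfl)
  have c4 := ch q (Or.inr rfl)
  have hxz : x ≠ z := by grind
  have hxb : x ≠ b := by grind
  have hza : z ≠ a := by grind
  refine ⟨x, a, b, z, by grind, hxb, hxz, hab, by grind, by grind, ?_⟩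
  simp only [Sym2.eq_iff]
  grind

lemma cyc_of {e f g h : Sym2 V} (he : ¬ e.IsDiag)
    (hf : ¬ f.IsDiag) (hg : ¬ g.IsDiag) (hh : ¬ h.IsDiag)
    (hef : e ≠ f) (heg : e ≠ g) (heh : e ≠ h) (hfg : f ≠ g) (hfh : f ≠ h) (hgh : g ≠ h)
    (ce : ∀ v ∈ e, v ∈ f ∨ v ∈ g ∨ v ∈ h)
    (cf : ∀ v ∈ f, v ∈ e ∨ v ∈ g ∨ v ∈ h) (cg : ∀ v ∈ g, v ∈ e ∨ v ∈ f ∨ v ∈ h)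
    (ch : ∀ v ∈ h, v ∈ e ∨ v ∈ f ∨ v ∈ g) : Cyc e f g h ∨ Cyc e g f h ∨ Cyc e f h g := by
  obtain ⟨a, b, hab⟩ : ∃ a b, e = s(a, b) := by
    induction e with | _ a b => exact ⟨a, b, rfl⟩
  have hne : a ≠ b := by rw [hab] at he; simpa using he
  have hba : e = s(b, a) := by rw [hab, Sym2.eq_swap]
  have key : ∀ k, a ∈ k → b ∈ k → e = k := fun k h1 h2 => by
    rw [hab]; exact ((Sym2.mem_and_mem_iff hne).1 ⟨h1, h2⟩).symm
  have ca := ce a (by simp [hab])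
  have cb := ce b (by simp [hab])
  have cf' : ∀ v ∈ f, v ∈ e ∨ v ∈ h ∨ v ∈ g := fun v hv => (cf v hv).imp_right Or.symm
  have cg' : ∀ v ∈ g, v ∈ e ∨ v ∈ h ∨ v ∈ f := fun v hv => (cg v hv).imp_right Or.symm
  have ch' : ∀ v ∈ h, v ∈ e ∨ v ∈ g ∨ v ∈ f := fun v hv => (ch v hv).imp_right Or.symm
  rcases ca with ca | ca | ca <;> rcases cb with cb | cb | cb
  · exact absurd (key _ ca cb) hef
  · exact Or.inr (Or.inr (cyc_aux hab hne hf hg hh hef heg heh hfg hfh hgh cf cg ch ca cb).rev.rot.rot)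
  · exact Or.inl (cyc_aux hab hne hf hh hg hef heh heg hfh hfg hgh.symm cf' ch cg ca cb).rev.rot.rot
  · exact Or.inr (Or.inr (cyc_aux hba hne.symm hf hg hh hef heg heh hfg hfh hgh cf cg ch cb ca).rev.rot.rot)
  · exact absurd (key _ ca cb) heg
  · exact Or.inr (Or.inl (cyc_aux hab hne hg hh hf heg heh hef hgh hfg.symm hfh.symm cg' ch' cf ca cb).rev.rot.rot)
  · exact Or.inl (cyc_aux hba hne.symm hf hh hg hef heh heg hfh hfg hgh.symm cf' ch cg cb ca).rev.rot.rot
  · exact Or.inr (Or.inl (cyc_aux hba hne.symm hg hh hf heg heh hef hgh hfg.symm hfh.symm cg' ch' cf cb ca).rev.rot.rot)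
  · exact absurd (key _ ca cb) heh

lemma tri_of {e f g : Sym2 V} (he : ¬ e.IsDiag) (hf : ¬ f.IsDiag) (hg : ¬ g.IsDiag)
    (hef : e ≠ f) (heg : e ≠ g) (hfg : f ≠ g)
    (ce : ∀ v ∈ e, v ∈ f ∨ v ∈ g)
    (cf : ∀ v ∈ f, v ∈ e ∨ v ∈ g) (cg : ∀ v ∈ g, v ∈ e ∨ v ∈ f) : Tri e f g := by
  have main : ∀ a b, e = s(a, b) → a ≠ b → b ∈ f → a ∈ g → Tri e f g := by
    intro a b hab hne hb ha
    obtain ⟨x, rfl⟩ := hb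
    obtain ⟨z, rfl⟩ := ha
    subst hab
    simp only [Sym2.mk_isDiag_iff, Sym2.mem_iff, ne_eq, Sym2.eq_iff] at *
    have c1 := cf x (Or.inr rfl)
    have c2 := cg z (Or.inr rfl)
    refine ⟨a, b, x, hne, by grind, by grind, ?_⟩
    simp only [Sym2.eq_iff]
    grind
  obtain ⟨a, b, hab⟩ : ∃ a b, e = s(a, b) := by
    induction e with | _ a b => exact ⟨a, b, rfl⟩
  have hne : a ≠ b := by rw [hab] at he; simpa using he
  have hba : e = s(b, a) := by rw [hab, Sym2.eq_swap]
  have key : ∀ k, a ∈ k → b ∈ k → e = k := fun k h1 h2 => by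
    rw [hab]; exact ((Sym2.mem_and_mem_iff hne).1 ⟨h1, h2⟩).symm
  have ca := ce a (by simp [hab])
  have cb := ce b (by simp [hab])
  rcases ca with ca | ca <;> rcases cb with cb | cb
  · exact absurd (key _ ca cb) hef
  · exact main b a hba hne.symm ca cb
  · exact main a b hab hne cb ca
  · exact absurd (key _ ca cb) heg

/-! expectations -/

section
variable {c : ℕ}

lemma y_mk (u v : V) (X : V → Fin c) :
    y s(u, v) X = (if X u = X v then 1 else 0) - 1 / (c : ℝ) := by
  simp [y]

lemma y_update {e : Sym2 V} {v : V} (h : v ∉ e) (X : V → Fin c) (a : Fin c) :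
    y e (Function.update X v a) = y e X := by
  induction e with | _ p q =>
  simp only [Sym2.mem_iff, not_or] at h
  simp [y_mk, Function.update_of_ne (Ne.symm h.1), Function.update_of_ne (Ne.symm h.2)]

lemma Ex_update (v : V) (hc : c ≠ 0) (g : (V → Fin c) → ℝ) :
    Ex g = Ex fun X => (∑ a, g (Function.update X v a)) / c := by
  unfold Ex
  congr 1
  rw [← Finset.sum_div, eq_div_iff (by exact_mod_cast hc)]
  have e := Equiv.funSplitAt v (Fin c)
  rw [← (Equiv.funSplitAt v (Fin c)).symm.sum_comp, ← (Equiv.funSplitAt v (Fin c)).symm.sum_comp,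
    Fintype.sum_prod_type, Fintype.sum_prod_type]
  have : ∀ (b : Fin c) (r : {j // j ≠ v} → Fin c) (a : Fin c),
      Function.update ((Equiv.funSplitAt v (Fin c)).symm (b, r)) v a
        = (Equiv.funSplitAt v (Fin c)).symm (a, r) := by
    intro b r a
    ext j
    by_cases h : j = v
    · subst h; simp
    · simp [h]
  simp only [this, sum_const, card_univ, Fintype.card_fin, nsmul_eq_mul]
  rw [mul_comm, Finset.sum_comm]

lemma sum_ind (hc : c ≠ 0) (x : Fin c) :
    ∑ a : Fin c, (((if a = x then 1 else 0) : ℝ) - 1 / (c : ℝ)) = 0 := by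
  have : (c : ℝ) ≠ 0 := by exact_mod_cast hc
  simp [Finset.sum_sub_distrib, this]

lemma sum_ind2 (hc : c ≠ 0) (x z : Fin c) :
    (∑ a : Fin c, (((if x = a then 1 else 0) : ℝ) - 1 / (c : ℝ)) *
      (((if a = z then 1 else 0) : ℝ) - 1 / (c : ℝ))) / c
      = (1 / c) * ((if x = z then 1 else 0) - 1 / (c : ℝ)) := by
  have : (c : ℝ) ≠ 0 := by exact_mod_cast hc
  simp only [sub_mul, mul_sub, Finset.sum_sub_distrib, ← Finset.sum_mul, ← Finset.mul_sum]
  by_cases h : x = z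
  · simp [h]
    field_simp
    ring
  · simp [h]
    field_simp
    ring

lemma Ex_leaf (hc : c ≠ 0) {e : Sym2 V} {v : V} (he : ¬ e.IsDiag) (hv : v ∈ e)
    (F : (V → Fin c) → ℝ) (hF : ∀ X a, F (Function.update X v a) = F X) :
    Ex (fun X => y e X * F X) = 0 := by
  obtain ⟨w, rfl⟩ := hv
  have hw : w ≠ v := by simpa [eq_comm] using he
  rw [Ex_update v hc]
  simp only [hF, y_mk, Function.update_self, Function.update_of_ne hw, ← Finset.sum_mul,
    sum_ind hc]
  simp [Ex]

lemma Ex_int (hc : c ≠ 0) {u v w : V} (hu : u ≠ v) (hw : w ≠ v)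
    (F : (V → Fin c) → ℝ) (hF : ∀ X a, F (Function.update X v a) = F X) :
    Ex (fun X => y s(u, v) X * y s(v, w) X * F X) = (1 / c) * Ex (fun X => y s(u, w) X * F X) := by
  rw [Ex_update v hc]
  simp only [hF, y_mk, Function.update_self, Function.update_of_ne hw, Function.update_of_ne hu,
    ← Finset.sum_mul]
  have : ∀ X : V → Fin c, (∑ a : Fin c, (((if X u = a then 1 else 0) : ℝ) - 1 / (c : ℝ)) *
      (((if a = X w then 1 else 0) : ℝ) - 1 / (c : ℝ))) * F X / c
      = (1 / c) * (((if X u = X w then 1 else 0) - 1 / (c : ℝ)) * F X) := by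
    intro X
    rw [mul_div_right_comm, sum_ind2 hc]; ring
  simp only [this, Ex, ← Finset.mul_sum, mul_div_assoc]

lemma Ex_const (hc : c ≠ 0) (r : ℝ) : Ex (fun _ : V → Fin c => r) = r := by
  have : (c : ℝ) ≠ 0 := by exact_mod_cast hc
  simp [Ex]
  field_simp

lemma Ex_add (f g : (V → Fin c) → ℝ) : Ex (fun X => f X + g X) = Ex f + Ex g := by
  simp [Ex, Finset.sum_add_distrib, add_div]

lemma Ex_mul (r : ℝ) (g : (V → Fin c) → ℝ) : Ex (fun X => r * g X) = r * Ex g := by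
  simp [Ex, ← Finset.mul_sum, mul_div_assoc]

lemma Ex_sum {ι : Type*} (s : Finset ι) (g : ι → (V → Fin c) → ℝ) :
    Ex (fun X => ∑ i ∈ s, g i X) = ∑ i ∈ s, Ex (g i) := by
  simp only [Ex, ← Finset.sum_div]
  rw [Finset.sum_comm]

lemma y_sq (hc : c ≠ 0) (e : Sym2 V) (X : V → Fin c) :
    y e X * y e X = (1 - 2 / c) * y e X + (1 / c) * (1 - 1 / c) := by
  unfold y
  split_ifs <;> ring

lemma Ex1 (hc : c ≠ 0) {e : Sym2 V} (he : ¬ e.IsDiag) : Ex (fun X : V → Fin c => y e X) = 0 := by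
  have := Ex_leaf hc he (Sym2.out_fst_mem e) (fun _ => 1) (fun _ _ => rfl)
  simpa using this

lemma exists_mem_not_mem {e f : Sym2 V} (he : ¬ e.IsDiag) (h : e ≠ f) : ∃ v ∈ e, v ∉ f := by
  induction e with | _ a b =>
  have hne : a ≠ b := by simpa using he
  by_contra! hh
  exact h ((Sym2.mem_and_mem_iff hne).1 ⟨hh a (by simp), hh b (by simp)⟩).symm

lemma Ex2 (hc : c ≠ 0) {e f : Sym2 V} (he : ¬ e.IsDiag) :
    Ex (fun X : V → Fin c => y e X * y f X) = if e = f then (1 / (c : ℝ)) * (1 - 1 / c) else 0 := by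
  split_ifs with h
  · subst h
    simp only [y_sq hc, Ex_add, Ex_mul, Ex1 hc he, Ex_const hc]; ring
  · obtain ⟨v, h1, h2⟩ := exists_mem_not_mem he h
    exact Ex_leaf hc he h1 _ (fun X a => y_update h2 X a)

open Classical in
lemma Ex3 (hc : c ≠ 0) {e f g : Sym2 V} (he : ¬ e.IsDiag) (hf : ¬ f.IsDiag) (hg : ¬ g.IsDiag) :
    Ex (fun X : V → Fin c => y e X * y f X * y g X)
      = (1 / (c : ℝ)) ^ 2 * (1 - 1 / c) * (if Tri e f g then 1 else 0) +
        (1 - 2 / c) * ((1 / (c : ℝ)) * (1 - 1 / c)) * (if e = f ∧ f = g then 1 else 0) := by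
  have two : ∀ {e f : Sym2 V}, ¬ e.IsDiag → ¬ f.IsDiag →
      Ex (fun X : V → Fin c => y e X * y e X * y f X) =
      (1 - 2 / c) * ((1 / (c : ℝ)) * (1 - 1 / c)) * (if e = f then 1 else 0) := by
    intro e f he hf
    simp only [y_sq hc, add_mul, mul_assoc, Ex_add, Ex_mul, Ex1 hc hf, Ex2 hc he]
    split_ifs <;> ring
  by_cases h1 : e = f
  · subst h1
    have : ¬ Tri e e g := fun h => h.facts.1 rfl
    simp [this, two he hg]
  by_cases h2 : e = g
  · subst h2
    have : ¬ Tri e f e := fun h => h.facts.2.1 rfl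
    have h3 : (fun X : V → Fin c => y e X * y f X * y e X) = fun X => y e X * y e X * y f X := by
      ext; ring
    simp [this, h3, two he hf, h1]
  by_cases h3 : f = g
  · subst h3
    have : ¬ Tri e f f := fun h => h.facts.2.2 rfl
    have h3 : (fun X : V → Fin c => y e X * y f X * y f X) = fun X => y f X * y f X * y e X := by
      ext; ring
    simp [this, h3, two hf he, h1, Ne.symm h1]
  by_cases ht : Tri e f g
  · obtain ⟨u, v, w, huv, hvw, hwu, rfl, rfl, rfl⟩ := ht
    rw [Ex_int hc huv hvw.symm _ (fun X a => y_update (by simp [hvw, huv.symm]) X a),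
      Ex2 hc (by simpa using hwu.symm), if_pos Sym2.eq_swap, if_pos ⟨u, v, w, huv, hvw, hwu, rfl, rfl, rfl⟩,
      if_neg (fun h => h1 h.1)]
    ring
  · simp only [ht, h1, if_false, false_and, mul_zero, add_zero]
    by_contra hne
    apply ht
    have leaf : ∀ {e f g : Sym2 V}, ¬ e.IsDiag →
        Ex (fun X : V → Fin c => y e X * y f X * y g X) ≠ 0 → ∀ v ∈ e, v ∈ f ∨ v ∈ g := by
      intro e f g he h v hv
      by_contra! hh
      apply h
      simp only [mul_assoc]
      exact Ex_leaf hc he hv _ (fun X a => by rw [y_update hh.1, y_update hh.2])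
    refine tri_of he hf hg h1 h2 h3 (leaf he hne) (leaf hf ?_) (leaf hg ?_)
    · convert hne using 3; ring
    · convert hne using 3; ring

lemma Ex4_cyc (hc : c ≠ 0) {e f g h : Sym2 V} (H : Cyc e f g h) :
    Ex (fun X : V → Fin c => y e X * y f X * y g X * y h X) = (1 / (c : ℝ)) ^ 3 * (1 - 1 / c) := by
  classical
  obtain ⟨a, b, x, d, h1, h2, h3, h4, h5, h6, rfl, rfl, rfl, rfl⟩ := H
  have := Ex_int (c := c) hc h1 h4.symm (fun X => y s(x, d) X * y s(d, a) X)
    (fun X r => by rw [y_update (by simp [h4, h5]), y_update (by simp [h5, h1.symm])])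
  simp only [← mul_assoc] at this ⊢
  rw [this, Ex3 hc (by simpa using h2) (by simpa using h6) (by simpa using h3.symm),
    if_pos ⟨a, x, d, h2, h6, h3.symm, rfl, rfl, rfl⟩, if_neg]
  · ring
  · simp only [Sym2.eq_iff]; grind

open Classical in
lemma Ex4 (hc : c ≠ 0) {e f g h : Sym2 V} (he : ¬ e.IsDiag) (hf : ¬ f.IsDiag) (hg : ¬ g.IsDiag)
    (hh : ¬ h.IsDiag) (s a r3 r4 : ℝ) (hs : s = (1 / (c : ℝ)) * (1 - 1 / c)) (ha : a = 1 - 2 / c)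
    (hr3 : r3 = (1 / (c : ℝ)) ^ 2 * (1 - 1 / c)) (hr4 : r4 = (1 / (c : ℝ)) ^ 3 * (1 - 1 / c)) :
    Ex (fun X : V → Fin c => y e X * y f X * y g X * y h X)
      = s ^ 2 * ((if e = f ∧ g = h then 1 else 0) + (if e = g ∧ f = h then 1 else 0)
          + (if e = h ∧ f = g then 1 else 0))
        + (a ^ 2 * s - 2 * s ^ 2) * (if e = f ∧ f = g ∧ g = h then 1 else 0)
        + a * r3 * ((if e = f ∧ Tri e g h then 1 else 0) + (if e = g ∧ Tri e f h then 1 else 0)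
          + (if e = h ∧ Tri e f g then 1 else 0) + (if f = g ∧ Tri e f h then 1 else 0)
          + (if f = h ∧ Tri e f g then 1 else 0) + (if g = h ∧ Tri e f g then 1 else 0))
        + r4 * ((if Cyc e f g h then 1 else 0) + (if Cyc e g f h then 1 else 0)
          + (if Cyc e f h g then 1 else 0)) := by
  have two : ∀ {e f g : Sym2 V}, ¬ e.IsDiag → ¬ f.IsDiag → ¬ g.IsDiag →
      ∀ {p q r : Sym2 V}, ¬ p.IsDiag → ¬ q.IsDiag → ¬ r.IsDiag →
      (∀ X : V → Fin c, y e X * y f X * y g X = y p X * y q X * y r X) →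
      Ex (fun X : V → Fin c => y e X * y e X * y f X * y g X) =
      a * (r3 * (if Tri p q r then 1 else 0) + a * s * (if p = q ∧ q = r then 1 else 0))
        + s * (if f = g then s else 0) := by
    intro e f g he hf hg p q r hp hq hr hX
    subst hs ha hr3
    simp only [y_sq hc, add_mul, mul_assoc, Ex_add, Ex_mul, Ex2 hc hf]
    simp only [← mul_assoc, hX, Ex3 hc hp hq hr]
  have tri_no1 : ∀ e g : Sym2 V, ¬ Tri e e g := fun e g h => h.facts.1 rfl
  have tri_no2 : ∀ e g : Sym2 V, ¬ Tri e g e := fun e g h => h.facts.2.1 rfl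
  have tri_no3 : ∀ e g : Sym2 V, ¬ Tri e g g := fun e g h => h.facts.2.2 rfl
  have c1 : ∀ e g h : Sym2 V, ¬ Cyc e e g h := fun e g h H => H.facts.1 rfl
  have c2 : ∀ e g h : Sym2 V, ¬ Cyc e g e h := fun e g h H => H.facts.2.1 rfl
  have c3 : ∀ e g h : Sym2 V, ¬ Cyc e g h e := fun e g h H => H.facts.2.2.1 rfl
  have c4 : ∀ e g h : Sym2 V, ¬ Cyc e g g h := fun e g h H => H.facts.2.2.2.1 rfl
  have c5 : ∀ e g h : Sym2 V, ¬ Cyc e g h g := fun e g h H => H.facts.2.2.2.2.1 rfl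
  have c6 : ∀ e g h : Sym2 V, ¬ Cyc e g h h := fun e g h H => H.facts.2.2.2.2.2.1 rfl
  by_cases h1 : e = f
  · subst h1
    rw [two he hg hh he hg hh (fun X => rfl)]
    by_cases t : Tri e g h
    · obtain ⟨t1, t2, t3⟩ := t.facts
      simp [t, t1, t2, t3, tri_no1, tri_no2, tri_no3, c1, c2, c3, c4, c5, c6]
    · by_cases q1 : e = g
      · subst q1
        by_cases q2 : e = h
        · subst q2
          simp [tri_no1, c1]
          ring
        · simp [tri_no1, tri_no2, c1, c2, q2]
      · by_cases q2 : g = h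
        · subst q2
          simp [tri_no1, tri_no2, tri_no3, c1, c2, c3, c4, c5, c6, q1]
          ring
        · simp [t, tri_no1, tri_no2, tri_no3, c1, c2, c3, c4, c5, c6, q1, q2]
  by_cases h2 : e = g
  · subst h2
    have : (fun X : V → Fin c => y e X * y f X * y e X * y h X)
      = fun X : V → Fin c => y e X * y e X * y f X * y h X := by ext; ring
    rw [this, two he hf hh he hf hh (fun X => rfl)]
    simp only [tri_no1, tri_no2, tri_no3, c1, c2, c3, c4, c5, c6, h1, Ne.symm h1,
      false_and, and_false, if_false, mul_zero, add_zero, zero_add, true_and, and_true]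
    split_ifs <;> first | ring | grind
  by_cases h3 : e = h
  · subst h3
    have : (fun X : V → Fin c => y e X * y f X * y g X * y e X)
      = fun X : V → Fin c => y e X * y e X * y f X * y g X := by ext; ring
    rw [this, two he hf hg he hf hg (fun X => rfl)]
    simp only [tri_no1, tri_no2, tri_no3, c1, c2, c3, c4, c5, c6, h1, Ne.symm h1, h2, Ne.symm h2,
      false_and, and_false, if_false, mul_zero, add_zero, zero_add, true_and, and_true]
    split_ifs <;> first | ring | grind
  by_cases h4 : f = g
  · subst h4
    have : (fun X : V → Fin c => y e X * y f X * y f X * y h X)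
      = fun X : V → Fin c => y f X * y f X * y e X * y h X := by ext; ring
    rw [this, two hf he hh he hf hh (fun X => by ring)]
    simp only [tri_no1, tri_no2, tri_no3, c1, c2, c3, c4, c5, c6, h1, Ne.symm h1, h2, Ne.symm h2,
      false_and, and_false, if_false, mul_zero, add_zero, zero_add, true_and, and_true]
    split_ifs <;> first | ring | grind
  by_cases h5 : f = h
  · subst h5
    have : (fun X : V → Fin c => y e X * y f X * y g X * y f X)
      = fun X : V → Fin c => y f X * y f X * y e X * y g X := by ext; ring
    rw [this, two hf he hg he hf hg (fun X => by ring)]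
    simp only [tri_no1, tri_no2, tri_no3, c1, c2, c3, c4, c5, c6, h1, Ne.symm h1, h2, Ne.symm h2, h3, Ne.symm h3, h4, Ne.symm h4,
      false_and, and_false, if_false, mul_zero, add_zero, zero_add, true_and, and_true]
    split_ifs <;> first | ring | grind
  by_cases h6 : g = h
  · subst h6
    have : (fun X : V → Fin c => y e X * y f X * y g X * y g X)
      = fun X : V → Fin c => y g X * y g X * y e X * y f X := by ext; ring
    rw [this, two hg he hf he hf hg (fun X => by ring)]
    simp only [tri_no1, tri_no2, tri_no3, c1, c2, c3, c4, c5, c6, h1, Ne.symm h1, h2, Ne.symm h2, h3, Ne.symm h3, h4, Ne.symm h4, h5, Ne.symm h5,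
      false_and, and_false, if_false, mul_zero, add_zero, zero_add, true_and, and_true]
    split_ifs <;> first | ring | grind
  simp only [h1, h2, h3, h4, h5, h6, false_and, if_false, mul_zero, add_zero, zero_add]
  by_cases k1 : Cyc e f g h
  · have n2 : ¬ Cyc e g f h := fun H => by
      obtain ⟨v, hv, hv'⟩ := H.facts.2.2.2.2.2.2.2.1
      exact k1.facts.2.2.2.2.2.2.1 v hv hv'
    have n3 : ¬ Cyc e f h g := fun H => by
      obtain ⟨v, hv, hv'⟩ := H.facts.2.2.2.2.2.2.2.2
      exact k1.facts.2.2.2.2.2.2.1 v hv hv'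
    rw [Ex4_cyc hc k1, if_pos k1, if_neg n2, if_neg n3, hr4]; ring
  by_cases k2 : Cyc e g f h
  · have n3 : ¬ Cyc e f h g := fun H => by
      obtain ⟨v, hv, hv'⟩ := H.facts.2.2.2.2.2.2.2.1
      exact k2.facts.2.2.2.2.2.2.1 v hv hv'
    have : (fun X : V → Fin c => y e X * y f X * y g X * y h X)
      = fun X : V → Fin c => y e X * y g X * y f X * y h X := by ext; ring
    rw [this, Ex4_cyc hc k2, if_neg k1, if_pos k2, if_neg n3, hr4]; ring
  by_cases k3 : Cyc e f h g
  · have : (fun X : V → Fin c => y e X * y f X * y g X * y h X)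
      = fun X : V → Fin c => y e X * y f X * y h X * y g X := by ext; ring
    rw [this, Ex4_cyc hc k3, if_neg k1, if_neg k2, if_pos k3, hr4]; ring
  rw [if_neg k1, if_neg k2, if_neg k3]
  by_contra hne
  have hne : Ex (fun X : V → Fin c => y e X * y f X * y g X * y h X) ≠ 0 := by simpa using hne
  have leaf : ∀ {e f g h : Sym2 V}, ¬ e.IsDiag →
      Ex (fun X : V → Fin c => y e X * y f X * y g X * y h X) ≠ 0 →
      ∀ v ∈ e, v ∈ f ∨ v ∈ g ∨ v ∈ h := by
    intro e f g h he H v hv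
    by_contra! hh
    apply H
    simp only [mul_assoc]
    exact Ex_leaf hc he hv _ (fun X a => by rw [y_update hh.1, y_update hh.2.1, y_update hh.2.2])
  have := cyc_of he hf hg hh h1 h2 h3 h4 h5 h6 (leaf he hne)
    (leaf hf (by convert hne using 3; ring)) (leaf hg (by convert hne using 3; ring))
    (leaf hh (by convert hne using 3; ring))
  tauto

end

/-! counting -/

section
variable (G : SimpleGraph V) [DecidableRel G.Adj]

open Classical in
lemma sum_cyc : ∑ e ∈ G.edgeFinset, ∑ f ∈ G.edgeFinset, ∑ g ∈ G.edgeFinset, ∑ h ∈ G.edgeFinset,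
    (if Cyc e f g h then (1 : ℝ) else 0) = orderedFourCycles G := by
  have : orderedFourCycles G = ((G.edgeFinset ×ˢ G.edgeFinset ×ˢ G.edgeFinset ×ˢ G.edgeFinset).filter
      (fun q => Cyc q.1 q.2.1 q.2.2.1 q.2.2.2)).card := by
    unfold orderedFourCycles
    rw [Nat.card_eq_fintype_card, Fintype.card_subtype]
    refine Finset.card_bij (fun v _ => (s(v 0, v 1), s(v 1, v 2), s(v 2, v 3), s(v 3, v 0))) ?_ ?_ ?_
    · intro v hv
      simp only [mem_filter, mem_univ, true_and] at hv
      obtain ⟨hi, h1, h2, h3, h4⟩ := hv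
      simp only [mem_filter, mem_product, SimpleGraph.mem_edgeFinset, SimpleGraph.mem_edgeSet]
      exact ⟨⟨h1, h2, h3, h4⟩, v 0, v 1, v 2, v 3, hi.ne (by decide), hi.ne (by decide),
        hi.ne (by decide), hi.ne (by decide), hi.ne (by decide), hi.ne (by decide), rfl, rfl, rfl, rfl⟩
    · intro v hv w hw h
      simp only [mem_filter, mem_univ, true_and] at hv hw
      have a1 : v 0 ≠ v 1 := hv.1.ne (by decide)
      have a2 : v 0 ≠ v 2 := hv.1.ne (by decide)
      have a3 : v 0 ≠ v 3 := hv.1.ne (by decide)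
      have a4 : v 1 ≠ v 2 := hv.1.ne (by decide)
      have a5 : v 1 ≠ v 3 := hv.1.ne (by decide)
      have a6 : v 2 ≠ v 3 := hv.1.ne (by decide)
      simp only [Prod.mk.injEq, Sym2.eq_iff] at h
      clear hv hw
      have : v 0 = w 0 ∧ v 1 = w 1 ∧ v 2 = w 2 ∧ v 3 = w 3 := by grind
      ext i
      fin_cases i
      exacts [this.1, this.2.1, this.2.2.1, this.2.2.2]
    · rintro ⟨e, f, g, h⟩ hq
      simp only [mem_filter, mem_product, SimpleGraph.mem_edgeFinset] at hq
      obtain ⟨⟨m1, m2, m3, m4⟩, a, b, x, d, h1, h2, h3, h4, h5, h6, rfl, rfl, rfl, rfl⟩ := hq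
      refine ⟨![a, b, x, d], ?_, rfl⟩
      simp only [mem_filter, mem_univ, true_and]
      refine ⟨?_, m1, m2, m3, m4⟩
      intro i j hij
      fin_cases i <;> fin_cases j <;> simp_all
  rw [this, Finset.card_filter]
  push_cast
  simp only [Finset.sum_product]

open Classical in
lemma sum_tri : ∑ e ∈ G.edgeFinset, ∑ f ∈ G.edgeFinset, ∑ g ∈ G.edgeFinset,
    (if Tri e f g then (1 : ℝ) else 0) = 6 * ((G.cliqueFinset 3).card : ℝ) := by
  have h1 : ((G.edgeFinset ×ˢ G.edgeFinset ×ˢ G.edgeFinset).filter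
      (fun q => Tri q.1 q.2.1 q.2.2)).card = ((univ : Finset (V × V × V)).filter
      (fun q => G.Adj q.1 q.2.1 ∧ G.Adj q.2.1 q.2.2 ∧ G.Adj q.2.2 q.1)).card := by
    symm
    refine Finset.card_bij (fun v _ => (s(v.1, v.2.1), s(v.2.1, v.2.2), s(v.2.2, v.1))) ?_ ?_ ?_
    · rintro ⟨u, v, w⟩ hv
      simp only [mem_filter, mem_univ, true_and] at hv
      obtain ⟨h1, h2, h3⟩ := hv
      simp only [mem_filter, mem_product, SimpleGraph.mem_edgeFinset, SimpleGraph.mem_edgeSet]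
      exact ⟨⟨h1, h2, h3⟩, u, v, w, h1.ne, h2.ne, h3.ne, rfl, rfl, rfl⟩
    · rintro ⟨u, v, w⟩ hv ⟨u', v', w'⟩ hv' h
      simp only [mem_filter, mem_univ, true_and] at hv hv'
      have a1 := hv.1.ne
      have a2 := hv.2.1.ne
      have a3 := hv.2.2.ne
      simp only [Prod.mk.injEq, Sym2.eq_iff] at h ⊢
      clear hv hv'
      grind
    · rintro ⟨e, f, g⟩ hq
      simp only [mem_filter, mem_product, SimpleGraph.mem_edgeFinset] at hq
      obtain ⟨⟨m1, m2, m3⟩, a, b, x, h1, h2, h3, rfl, rfl, rfl⟩ := hq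
      refine ⟨(a, b, x), ?_, rfl⟩
      simp only [mem_filter, mem_univ, true_and]
      exact ⟨m1, m2, m3⟩
  have h2 : ((univ : Finset (V × V × V)).filter
      (fun q => G.Adj q.1 q.2.1 ∧ G.Adj q.2.1 q.2.2 ∧ G.Adj q.2.2 q.1)).card
      = ∑ t ∈ G.cliqueFinset 3, 6 := by
    rw [Finset.card_eq_sum_card_fiberwise (f := fun q : V × V × V => ({q.1, q.2.1, q.2.2} : Finset V))
      (t := G.cliqueFinset 3)]
    · refine Finset.sum_congr rfl ?_
      intro t ht
      rw [SimpleGraph.mem_cliqueFinset_iff, SimpleGraph.is3Clique_iff] at ht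
      obtain ⟨a, b, x, hab, hax, hbx, rfl⟩ := ht
      have n1 := hab.ne
      have n2 := hax.ne
      have n3 := hbx.ne
      have : ({(a, b, x), (a, x, b), (b, a, x), (b, x, a), (x, a, b), (x, b, a)} :
        Finset (V × V × V)).card = 6 := by
        simp [Finset.card_insert_of_notMem, n1, n2, n3, n1.symm, n2.symm, n3.symm]
      rw [← this]
      congr 1
      ext ⟨u, v, w⟩
      simp only [mem_filter, mem_univ, true_and, mem_insert, mem_singleton, Prod.mk.injEq]
      constructor
      · rintro ⟨⟨e1, e2, e3⟩, heq⟩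
        have hu : u ∈ ({a, b, x} : Finset V) := by rw [← heq]; simp
        have hv : v ∈ ({a, b, x} : Finset V) := by rw [← heq]; simp
        have hw : w ∈ ({a, b, x} : Finset V) := by rw [← heq]; simp
        simp only [mem_insert, mem_singleton] at hu hv hw
        have := e1.ne
        have := e2.ne
        have := e3.ne
        clear heq
        grind
      · have s1 := hab.symm
        have s2 := hax.symm
        have s3 := hbx.symm
        rintro (⟨rfl, rfl, rfl⟩ | ⟨rfl, rfl, rfl⟩ | ⟨rfl, rfl, rfl⟩ | ⟨rfl, rfl, rfl⟩ |
          ⟨rfl, rfl, rfl⟩ | ⟨rfl, rfl, rfl⟩) <;> refine ⟨⟨by assumption, by assumption, by assumption⟩, ?_⟩ <;>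
          ext z <;> simp only [mem_insert, mem_singleton] <;> grind
    · rintro ⟨u, v, w⟩ hq
      simp only [coe_filter, mem_univ, true_and, Set.mem_setOf_eq] at hq
      simp only [SetLike.mem_coe, SimpleGraph.mem_cliqueFinset_iff, SimpleGraph.is3Clique_iff]
      exact ⟨u, v, w, hq.1, hq.2.2.symm, hq.2.1, rfl⟩
  have h3 := h1.trans h2
  rw [Finset.card_filter, Finset.sum_const, smul_eq_mul] at h3
  have h4 := congrArg (Nat.cast : ℕ → ℝ) h3
  push_cast at h4
  simp only [Finset.sum_product] at h4
  rw [h4]; ring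

end

lemma S_eq (G : SimpleGraph V) [DecidableRel G.Adj] {c : ℕ} (X : V → Fin c) :
    (monochromaticEdges G X : ℝ) - (G.edgeFinset.card : ℝ) / c = ∑ e ∈ G.edgeFinset, y e X := by
  simp only [y, Finset.sum_sub_distrib, monochromaticEdges, Finset.card_filter]
  push_cast
  simp [div_eq_mul_inv]

lemma pow4 (E : Finset (Sym2 V)) {c : ℕ} (X : V → Fin c) :
    (∑ e ∈ E, y e X) ^ 4 = ∑ e ∈ E, ∑ f ∈ E, ∑ g ∈ E, ∑ h ∈ E, y e X * y f X * y g X * y h X := by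
  simp only [← Finset.mul_sum, ← Finset.sum_mul]
  ring

open Classical in
lemma fourth (G : SimpleGraph V) [DecidableRel G.Adj] {c : ℕ} (hc : c ≠ 0)
    (s a r3 r4 : ℝ) (hs : s = (1 / (c : ℝ)) * (1 - 1 / c)) (ha : a = 1 - 2 / c)
    (hr3 : r3 = (1 / (c : ℝ)) ^ 2 * (1 - 1 / c)) (hr4 : r4 = (1 / (c : ℝ)) ^ 3 * (1 - 1 / c)) :
    Ex (fun X : V → Fin c => (∑ e ∈ G.edgeFinset, y e X) ^ 4) =
      3 * s ^ 2 * (G.edgeFinset.card : ℝ) ^ 2 + (a ^ 2 * s - 2 * s ^ 2) * G.edgeFinset.card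
      + a * r3 * (36 * ((G.cliqueFinset 3).card : ℝ)) + r4 * (3 * orderedFourCycles G) := by
  have nd : ∀ e ∈ G.edgeFinset, ¬ e.IsDiag := fun e he =>
    G.not_isDiag_of_mem_edgeSet (SimpleGraph.mem_edgeFinset.1 he)
  have T := sum_tri G
  have C := sum_cyc G
  simp only [pow4, Ex_sum]
  rw [Finset.sum_congr rfl fun e he => Finset.sum_congr rfl fun f hf => Finset.sum_congr rfl
    fun g hg => Finset.sum_congr rfl fun h hh =>
      Ex4 hc (nd e he) (nd f hf) (nd g hg) (nd h hh) s a r3 r4 hs ha hr3 hr4]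
  generalize G.edgeFinset = E at *
  simp only [Finset.sum_add_distrib, ← Finset.mul_sum]
  have C2 : ∑ e ∈ E, ∑ f ∈ E, ∑ g ∈ E, ∑ h ∈ E, (if Cyc e g f h then (1 : ℝ) else 0)
      = orderedFourCycles G := by
    rw [← C]; exact Finset.sum_congr rfl fun e _ => Finset.sum_comm
  have C3 : ∑ e ∈ E, ∑ f ∈ E, ∑ g ∈ E, ∑ h ∈ E, (if Cyc e f h g then (1 : ℝ) else 0)
      = orderedFourCycles G := by
    rw [← C]; exact Finset.sum_congr rfl fun e _ => Finset.sum_congr rfl fun f _ => Finset.sum_comm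
  have A1 : ∑ e ∈ E, ∑ f ∈ E, ∑ g ∈ E, ∑ h ∈ E, (if e = f ∧ g = h then (1 : ℝ) else 0)
      = (E.card : ℝ) ^ 2 := by
    simp +contextual [ite_and, Finset.sum_ite_eq, pow_two]
  have A2 : ∑ e ∈ E, ∑ f ∈ E, ∑ g ∈ E, ∑ h ∈ E, (if e = g ∧ f = h then (1 : ℝ) else 0)
      = (E.card : ℝ) ^ 2 := by
    rw [← A1]; exact Finset.sum_congr rfl fun e _ => Finset.sum_comm
  have A3 : ∑ e ∈ E, ∑ f ∈ E, ∑ g ∈ E, ∑ h ∈ E, (if e = h ∧ f = g then (1 : ℝ) else 0)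
      = (E.card : ℝ) ^ 2 := by
    rw [← A2]; exact Finset.sum_congr rfl fun e _ => Finset.sum_congr rfl fun f _ => Finset.sum_comm
  have A4 : ∑ e ∈ E, ∑ f ∈ E, ∑ g ∈ E, ∑ h ∈ E, (if e = f ∧ f = g ∧ g = h then (1 : ℝ) else 0)
      = (E.card : ℝ) := by
    simp +contextual [ite_and, Finset.sum_ite_eq]
  set N : ℝ := 6 * ((G.cliqueFinset 3).card : ℝ) with hN
  have B1 : ∑ e ∈ E, ∑ f ∈ E, ∑ g ∈ E, ∑ h ∈ E, (if e = f ∧ Tri e g h then (1 : ℝ) else 0) = N := by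
    rw [← T]
    refine Finset.sum_congr rfl fun e he => ?_
    rw [Finset.sum_eq_single_of_mem e he (fun b _ hb => by simp [hb.symm])]
    simp
  have B2 : ∑ e ∈ E, ∑ f ∈ E, ∑ g ∈ E, ∑ h ∈ E, (if e = g ∧ Tri e f h then (1 : ℝ) else 0) = N := by
    rw [← B1]; exact Finset.sum_congr rfl fun e _ => Finset.sum_comm
  have B3 : ∑ e ∈ E, ∑ f ∈ E, ∑ g ∈ E, ∑ h ∈ E, (if e = h ∧ Tri e f g then (1 : ℝ) else 0) = N := by
    rw [← B2]; exact Finset.sum_congr rfl fun e _ => Finset.sum_congr rfl fun f _ => Finset.sum_comm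
  have B4 : ∑ e ∈ E, ∑ f ∈ E, ∑ g ∈ E, ∑ h ∈ E, (if f = g ∧ Tri e f h then (1 : ℝ) else 0) = N := by
    rw [← T]
    refine Finset.sum_congr rfl fun e he => Finset.sum_congr rfl fun f hf => ?_
    rw [Finset.sum_eq_single_of_mem f hf (fun b _ hb => by simp [hb.symm])]
    simp
  have B5 : ∑ e ∈ E, ∑ f ∈ E, ∑ g ∈ E, ∑ h ∈ E, (if f = h ∧ Tri e f g then (1 : ℝ) else 0) = N := by
    rw [← B4]; exact Finset.sum_congr rfl fun e _ => Finset.sum_congr rfl fun f _ => Finset.sum_comm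
  have B6 : ∑ e ∈ E, ∑ f ∈ E, ∑ g ∈ E, ∑ h ∈ E, (if g = h ∧ Tri e f g then (1 : ℝ) else 0) = N := by
    rw [← T]
    refine Finset.sum_congr rfl fun e he => Finset.sum_congr rfl fun f hf =>
      Finset.sum_congr rfl fun g hg => ?_
    rw [Finset.sum_eq_single_of_mem g hg (fun b _ hb => by simp [hb.symm])]
    simp
  rw [A1, A2, A3, A4, B1, B2, B3, B4, B5, B6, C, C2, C3, hN]
  ring

end FM

/-- Fourth moment identity for the standardized number of monochromatic edges
`Z₂ = (T₂ - E T₂)/σ` under a uniformly random `c`-coloring (`c ≥ 2`) of a finite simple graph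
with at least one edge:
`E[Z₂⁴] - 3 = (γ₁ |E| + γ₂ N(K₃,G) + γ₃ N(C₄,G)) / σ⁴`, where `σ² = (|E|/c)(1 - 1/c)`,
`γ₁ = (1/c)(1 - 7/c + 12/c² - 6/c³)`, `γ₂ = (36/c²)(1 - 1/c)(1 - 2/c)`, and
`γ₃ = (24/c³)(1 - 1/c)`. -/
theorem fourth_moment_monochromatic_edges {V : Type*} [Fintype V] [DecidableEq V]
    (G : SimpleGraph V) [DecidableRel G.Adj] (c : ℕ) (hc : 2 ≤ c)
    (hE : 0 < G.edgeFinset.card) :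
    (∑ X : V → Fin c,
        (((monochromaticEdges G X : ℝ) - (G.edgeFinset.card : ℝ) / c)
          / Real.sqrt (((G.edgeFinset.card : ℝ) / c) * (1 - 1 / c))) ^ 4)
        / (c : ℝ) ^ Fintype.card V - 3
      = ((1 / (c : ℝ)) * (1 - 7 / c + 12 / (c : ℝ) ^ 2 - 6 / (c : ℝ) ^ 3)
            * (G.edgeFinset.card : ℝ)
          + (36 / (c : ℝ) ^ 2) * (1 - 1 / c) * (1 - 2 / c) * ((G.cliqueFinset 3).card : ℝ)
          + (24 / (c : ℝ) ^ 3) * (1 - 1 / c) * ((orderedFourCycles G : ℝ) / 8))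
        / (((G.edgeFinset.card : ℝ) / c) * (1 - 1 / c)) ^ 2 := by
  have hc0 : c ≠ 0 := by omega
  have hcR : (2 : ℝ) ≤ c := by exact_mod_cast hc
  have hm : (0 : ℝ) < (G.edgeFinset.card : ℝ) := by exact_mod_cast hE
  have hp : (0 : ℝ) < 1 - 1 / (c : ℝ) := by
    rw [sub_pos, div_lt_one (by linarith)]; linarith
  have hσ : 0 < ((G.edgeFinset.card : ℝ) / c) * (1 - 1 / c) := by
    have : (0 : ℝ) < c := by linarith
    positivity
  have key := FM.fourth G hc0 _ _ _ _ rfl rfl rfl rfl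
  have h4 : Real.sqrt (((G.edgeFinset.card : ℝ) / c) * (1 - 1 / c)) ^ 4
      = (((G.edgeFinset.card : ℝ) / c) * (1 - 1 / c)) ^ 2 := by
    rw [show (4 : ℕ) = 2 * 2 from rfl, pow_mul, Real.sq_sqrt hσ.le]
  simp only [div_pow, h4, FM.S_eq, ← Finset.sum_div]
  rw [div_right_comm]
  unfold FM.Ex at key
  rw [key, sub_eq_iff_eq_add, div_eq_iff (by positivity), add_mul, div_mul_cancel₀ _ (by positivity)]
  have : (c : ℝ) ≠ 0 := by linarith
  field_simp
  ring
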